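/- arXiv:1803.05943 — 2 statements merged into one kernel-verified Lean document; each statement's English description precedes it below -/
import Mathlib

section
/- Fix t ∈ ℝ and β with 0 < β ≤ 1. Then there exists ρ > 0 such that for every real x and every real z with |z| < ρ, the series Σ_{n≥0} (Σ_{k=0}^n C(−t,k) β^k Δ^k I_n(x)) z^n/n! converges absolutely and equals e^{xz}/(1 + β(e^z − 1))^t; that is, the generalized Apostol-Euler polynomials E_n(t,β;x) of order t have associated sequence a_n(t) = (−t)(−t−1)⋯(−t−n+1)·β^n, so E_n(t,β;x) = Σ_{k=0}^n C(−t,k) β^k Δ^k I_n(x). -/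
open Finset MeasureTheory

/-- The `k`-th forward difference of `f : ℝ → ℝ`:
`Δ^k f(x) = ∑_{j=0}^k C(k,j) (-1)^(k-j) f(x+j)`. -/
noncomputable def fdiff (k : ℕ) (f : ℝ → ℝ) (x : ℝ) : ℝ :=
  ∑ j ∈ Finset.range (k + 1), (k.choose j : ℝ) * (-1 : ℝ) ^ (k - j) * f (x + j)

/-- The `k`-th forward difference of a real polynomial, as a polynomial;
its evaluation at `x` is `∑_{j=0}^k C(k,j) (-1)^(k-j) p(x+j)`. -/
noncomputable def fdiffP (k : ℕ) (p : Polynomial ℝ) : Polynomial ℝ :=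
  ∑ j ∈ Finset.range (k + 1),
    ((k.choose j : ℝ) * (-1 : ℝ) ^ (k - j)) • p.comp (Polynomial.X + Polynomial.C (j : ℝ))

/-- An Appell sequence of real polynomials: `A 0` is a nonzero constant and
`A n' = n • A (n-1)` for `n ≥ 1`. -/
def IsAppell (A : ℕ → Polynomial ℝ) : Prop :=
  (A 0).eval 0 ≠ 0 ∧ (∃ c : ℝ, A 0 = Polynomial.C c) ∧
    ∀ n : ℕ, (A (n + 1)).derivative = ((n : ℝ) + 1) • A n

/-- The forward difference transformation `L_u A`, with
`(L_u A)_n(x) = ∑_{k=0}^n (u_k/k!) Δ^k A_n(x)`. -/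
noncomputable def LP (u : ℕ → ℝ) (A : ℕ → Polynomial ℝ) (n : ℕ) : Polynomial ℝ :=
  ∑ k ∈ Finset.range (n + 1), (u k / (k.factorial : ℝ)) • fdiffP k (A n)

/-- Binomial convolution of real sequences. -/
noncomputable def bconv (u v : ℕ → ℝ) (n : ℕ) : ℝ :=
  ∑ k ∈ Finset.range (n + 1), (n.choose k : ℝ) * u k * v (n - k)

/-- Binomial convolution of Appell sequences:
`(A×C)_n(x) = ∑_{k=0}^n C(n,k) A_k(0) C_{n-k}(x)`. -/
noncomputable def aconv (A C : ℕ → Polynomial ℝ) (n : ℕ) : Polynomial ℝ :=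
  ∑ k ∈ Finset.range (n + 1), ((n.choose k : ℝ) * (A k).eval 0) • C (n - k)

/-- Stirling numbers of the second kind (real-valued):
`S(n,k) = (1/k!) ∑_{j=0}^k (-1)^(k-j) C(k,j) j^n`. -/
noncomputable def stirling2 (n k : ℕ) : ℝ :=
  (1 / (k.factorial : ℝ)) *
    ∑ j ∈ Finset.range (k + 1), (-1 : ℝ) ^ (k - j) * (k.choose j : ℝ) * (j : ℝ) ^ n

/-- Signed Stirling numbers of the first kind: the coefficient of `x^k` in
`x(x-1)⋯(x-n+1)`. -/
noncomputable def stirling1 (n k : ℕ) : ℝ :=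
  (∏ i ∈ Finset.range n, (Polynomial.X - Polynomial.C (i : ℝ))).coeff k

/-- Generalized binomial coefficient `C(y,k) = y(y-1)⋯(y-k+1)/k!`. -/
noncomputable def rchoose (y : ℝ) (k : ℕ) : ℝ :=
  (∏ i ∈ Finset.range k, (y - i)) / (k.factorial : ℝ)

/-- Apostol-Euler polynomials `E_n(β;x) = ∑_{k=0}^n (-β)^k Δ^k I_n(x)`. -/
noncomputable def apostolEuler (β : ℝ) (n : ℕ) (x : ℝ) : ℝ :=
  ∑ k ∈ Finset.range (n + 1), (-β) ^ k * fdiff k (fun y => y ^ n) x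

/-- Harmonic numbers `H_j = ∑_{i=1}^j 1/i`. -/
noncomputable def harm (j : ℕ) : ℝ := ∑ i ∈ Finset.range j, (1 : ℝ) / (i + 1)

theorem fdiff_eq_fwdDiff_iter (k : ℕ) (f : ℝ → ℝ) (x : ℝ) :
    fdiff k f x = (fwdDiff 1)^[k] f x := by
  rw [fwdDiff_iter_eq_sum_shift, fdiff]
  refine Finset.sum_congr rfl fun j _ => ?_
  simp [zsmul_eq_mul, mul_comm]

theorem fdiff_pow_eq_zero_of_lt {n k : ℕ} (h : n < k) (x : ℝ) :
    fdiff k (fun y => y ^ n) x = 0 := by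
  rw [fdiff_eq_fwdDiff_iter, fwdDiff_iter_pow_eq_zero_of_lt h, Pi.zero_apply]

theorem fdiff_succ_pow (k n : ℕ) (x : ℝ) :
    fdiff (k + 1) (fun y => y ^ n) x =
      ∑ i ∈ Finset.range n, (n.choose i : ℝ) * fdiff k (fun y => y ^ i) x := by
  have h : fwdDiff 1 (fun r : ℝ => r ^ n) =
      ∑ i ∈ Finset.range n, (n.choose i : ℝ) • fun r : ℝ => r ^ i := by
    ext y
    simp [fwdDiff, add_pow, Finset.sum_range_succ, mul_comm]
  simp only [fdiff_eq_fwdDiff_iter, Function.iterate_succ_apply, h, fwdDiff_iter_finsetSum,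
    fwdDiff_iter_const_smul, Finset.sum_apply, Pi.smul_apply, smul_eq_mul]

theorem abs_fdiff_pow_le (k n : ℕ) (x : ℝ) :
    |fdiff k (fun y => y ^ n) x| ≤ fdiff k (fun y => y ^ n) |x| := by
  induction k generalizing n with
  | zero => simp [fdiff]
  | succ k ih =>
    simp only [fdiff_succ_pow]
    refine (Finset.abs_sum_le_sum_abs _ _).trans (Finset.sum_le_sum fun i _ => ?_)
    rw [abs_mul, Nat.abs_cast]
    exact mul_le_mul_of_nonneg_left (ih i) (Nat.cast_nonneg _)

theorem hasSum_fdiff_pow (k : ℕ) (x z : ℝ) :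
    HasSum (fun n : ℕ => fdiff k (fun y => y ^ n) x * z ^ n / (n.factorial : ℝ))
      (Real.exp (x * z) * (Real.exp z - 1) ^ k) := by
  have h : ∀ j ∈ Finset.range (k + 1),
      HasSum (fun n : ℕ => (k.choose j : ℝ) * (-1 : ℝ) ^ (k - j) *
        (((x + j) * z) ^ n / (n.factorial : ℝ)))
        ((k.choose j : ℝ) * (-1 : ℝ) ^ (k - j) * Real.exp ((x + j) * z)) := fun j _ => by
    rw [Real.exp_eq_exp_ℝ]
    exact (NormedSpace.expSeries_div_hasSum_exp ((x + j) * z)).mul_left _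
  convert hasSum_sum h using 1
  · ext n
    simp only [fdiff, Finset.sum_mul, Finset.sum_div]
    refine Finset.sum_congr rfl fun j _ => ?_
    rw [mul_pow]
    ring
  · rw [sub_eq_add_neg, add_pow, Finset.mul_sum]
    refine Finset.sum_congr rfl fun j _ => ?_
    rw [add_mul, Real.exp_add, Real.exp_nat_mul]
    ring

theorem rchoose_eq_ringChoose (a : ℝ) (k : ℕ) : rchoose a k = Ring.choose a k := by
  rw [Ring.choose_eq_smul, Polynomial.descPochhammer_smeval_eq_ascPochhammer,
    Polynomial.ascPochhammer_smeval_cast, Polynomial.ascPochhammer_smeval_eq_eval,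
    ← descPochhammer_eval_eq_ascPochhammer, descPochhammer_eval_eq_prod_range, rchoose,
    smul_eq_mul, div_eq_inv_mul]

theorem hasSum_rchoose_mul_pow (a : ℝ) {u : ℝ} (hu : |u| < 1) :
    HasSum (fun k : ℕ => rchoose a k * u ^ k) ((1 + u) ^ a) := by
  have h := (Real.one_add_rpow_hasFPowerSeriesOnBall_zero (a := a)).hasSum (y := u)
    (by simpa [enorm_eq_nnnorm, ← NNReal.coe_lt_coe] using hu)
  simpa [rchoose_eq_ringChoose, binomialSeries, FormalMultilinearSeries.coeff_ofScalars,
    mul_comm] using h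

theorem abs_exp_sub_one_le_exp_abs_sub_one (z : ℝ) :
    |Real.exp z - 1| ≤ Real.exp |z| - 1 := by
  rcases le_total 0 z with hz | hz
  · rw [abs_of_nonneg hz, abs_of_nonneg (sub_nonneg.2 (Real.one_le_exp hz))]
  · rw [abs_of_nonpos hz, abs_of_nonpos (sub_nonpos.2 (Real.exp_le_one_iff.2 hz))]
    have h1 := Real.add_one_le_exp z
    have h2 := Real.add_one_le_exp (-z)
    nlinarith [Real.exp_pos z, Real.exp_pos (-z), Real.exp_neg z,
      mul_inv_cancel₀ (Real.exp_pos z).ne', sq_nonneg (Real.exp z - 1)]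

theorem summable_prod_rchoose_fdiff (a x : ℝ) {β z : ℝ} (hβ : 0 ≤ β)
    (hz : β * (Real.exp |z| - 1) < 1) :
    Summable (fun p : ℕ × ℕ => rchoose a p.1 * β ^ p.1 *
      (fdiff p.1 (fun y => y ^ p.2) x * z ^ p.2 / (p.2.factorial : ℝ))) := by
  have hu : 0 ≤ Real.exp |z| - 1 := sub_nonneg.2 (Real.one_le_exp (abs_nonneg z))
  have hk (k : ℕ) := (hasSum_fdiff_pow k |x| |z|).mul_left |rchoose a k * β ^ k|
  have hdom : Summable (fun p : ℕ × ℕ => |rchoose a p.1 * β ^ p.1| *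
      (fdiff p.1 (fun y => y ^ p.2) |x| * |z| ^ p.2 / (p.2.factorial : ℝ))) := by
    refine (summable_prod_of_nonneg fun p => ?_).2 ⟨fun k => (hk k).summable, ?_⟩
    · have := (abs_nonneg _).trans (abs_fdiff_pow_le p.1 p.2 x)
      simp only [Pi.zero_apply]
      positivity
    · simp only [fun k => (hk k).tsum_eq]
      have h := (hasSum_rchoose_mul_pow a (u := β * (Real.exp |z| - 1))
        (by rwa [abs_of_nonneg (mul_nonneg hβ hu)])).summable.abs.mul_left (Real.exp (|x| * |z|))
      refine h.congr fun k => ?_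
      rw [mul_pow, ← mul_assoc, abs_mul _ ((Real.exp |z| - 1) ^ k), abs_of_nonneg (pow_nonneg hu k)]
      ring
  refine hdom.of_norm_bounded fun p => ?_
  rw [Real.norm_eq_abs, abs_mul, abs_div, abs_mul _ (z ^ p.2), abs_pow z, Nat.abs_cast]
  gcongr
  exact abs_fdiff_pow_le p.1 p.2 x

theorem hasSum_generalizedApostolEuler (a x : ℝ) {β z : ℝ} (hβ : 0 ≤ β)
    (hz : β * (Real.exp |z| - 1) < 1) :
    HasSum (fun n : ℕ => (∑ k ∈ Finset.range (n + 1),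
        rchoose a k * β ^ k * fdiff k (fun y => y ^ n) x) * z ^ n / (n.factorial : ℝ))
      (Real.exp (x * z) * (1 + β * (Real.exp z - 1)) ^ a) := by
  have hu : |β * (Real.exp z - 1)| < 1 := by
    rw [abs_mul, abs_of_nonneg hβ]
    exact (mul_le_mul_of_nonneg_left (abs_exp_sub_one_le_exp_abs_sub_one z) hβ).trans_lt hz
  have hs := summable_prod_rchoose_fdiff a x hβ hz
  have hrow := hs.hasSum.prod_fiberwise fun k =>
    (hasSum_fdiff_pow k x z).mul_left (rchoose a k * β ^ k)
  have hval := (hasSum_rchoose_mul_pow a hu).mul_left (Real.exp (x * z))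
  have hrow' : HasSum (fun k => Real.exp (x * z) * (rchoose a k * (β * (Real.exp z - 1)) ^ k)) _ :=
    hrow.congr_fun fun k => by rw [mul_pow]; ring
  rw [hval.unique hrow']
  refine ((Equiv.prodComm ℕ ℕ).hasSum_iff.2 hs.hasSum).prod_fiberwise fun n => ?_
  have hzero : ∀ k ∉ Finset.range (n + 1),
      rchoose a k * β ^ k * fdiff k (fun y => y ^ n) x * z ^ n / (n.factorial : ℝ) = 0 :=
    fun k hk => by
      rw [fdiff_pow_eq_zero_of_lt (by rw [Finset.mem_range] at hk; omega)]
      simp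
  rw [Finset.sum_mul, Finset.sum_div]
  refine (hasSum_sum_of_ne_finset_zero hzero).congr_fun fun k => ?_
  simp only [Function.comp_apply, Equiv.prodComm_apply, Prod.swap_prod_mk]
  ring

/-- the generalized Apostol-Euler polynomials of real order `t` have
associated sequence `a_n(t) = (-t)_n β^n`, i.e. the generating function of
`∑_{k=0}^n C(-t,k) β^k Δ^k I_n(x)` is `e^{xz}/(1+β(e^z-1))^t`. -/
theorem generalizedApostolEuler_closed_form (t : ℝ) (β : ℝ) (hβ0 : 0 < β) (hβ1 : β ≤ 1) :
    ∃ ρ : ℝ, 0 < ρ ∧ ∀ x z : ℝ, |z| < ρ →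
      Summable (fun n => |(∑ k ∈ Finset.range (n + 1),
          rchoose (-t) k * β ^ k * fdiff k (fun y => y ^ n) x) * z ^ n / (n.factorial : ℝ)|) ∧
      ∑' n : ℕ, (∑ k ∈ Finset.range (n + 1),
          rchoose (-t) k * β ^ k * fdiff k (fun y => y ^ n) x) * z ^ n / (n.factorial : ℝ)
        = Real.exp (x * z) / (1 + β * (Real.exp z - 1)) ^ t := by
  refine ⟨Real.log 2, Real.log_pos one_lt_two, fun x z hz => ?_⟩
  have hexp : Real.exp |z| < 2 := (Real.lt_log_iff_exp_lt two_pos).1 hz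
  have hone : 1 ≤ Real.exp |z| := Real.one_le_exp (abs_nonneg z)
  have hu : β * (Real.exp |z| - 1) < 1 := by nlinarith
  have hpos : 0 < 1 + β * (Real.exp z - 1) := by nlinarith [Real.exp_pos z]
  have h := hasSum_generalizedApostolEuler (-t) x hβ0.le hu
  refine ⟨h.summable.abs, ?_⟩
  rw [h.tsum_eq, Real.rpow_neg hpos.le, div_eq_mul_inv]
end

section
/- Let m ∈ ℕ with m ≥ 1, let 0 ≤ β ≤ 1, let x_1, …, x_m be real numbers and x = x_1 + ⋯ + x_m. Then for every n ≥ 0, Σ_{j_1+⋯+j_m=n} (n!/(j_1!⋯j_m!)) E_{j_1}(β;x_1)⋯E_{j_m}(β;x_m) = Σ_{k=0}^n C(−m,k) β^k Δ^k I_n(x), where C(−m,k) = (−1)^k C(m+k−1,k). -/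
open Finset MeasureTheory

open PowerSeries in
/-- The terms of a substitution at a series without constant term that are of order greater than
`n` do not contribute to the `n`-th coefficient. -/
theorem PowerSeries.coeff_mul_subst_eq_sum_range {R : Type*} [CommRing R] {b : R⟦X⟧}
    (hb : constantCoeff b = 0) (e f : R⟦X⟧) (n : ℕ) :
    coeff n (e * f.subst b) = ∑ k ∈ range (n + 1), coeff k f * coeff n (e * b ^ k) := by
  have hcoeff {q k : ℕ} (h : q < k) : coeff q (b ^ k) = 0 :=
    X_pow_dvd_iff.1 (pow_dvd_pow_of_dvd (X_dvd_iff.2 hb) k) q h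
  have hsubst {q : ℕ} (hq : q ≤ n) :
      coeff q (f.subst b) = ∑ k ∈ range (n + 1), coeff k f * coeff q (b ^ k) := by
    rw [coeff_subst' (HasSubst.of_constantCoeff_zero' hb)]
    simp only [smul_eq_mul]
    refine finsum_eq_sum_of_support_subset _ fun k hk => ?_
    by_contra hkn
    simp only [coe_range, Set.mem_Iio] at hkn
    exact hk (by simp [hcoeff (show q < k by lia)])
  simp only [coeff_mul, mul_sum]
  rw [sum_comm]
  refine sum_congr rfl fun p hp => ?_
  rw [hsubst (HasAntidiagonal.mem_antidiagonal.1 hp ▸ Nat.le_add_left _ _), mul_sum]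
  exact sum_congr rfl fun k _ => by ring

open PowerSeries in
theorem PowerSeries.coeff_prod_eq_sum_antidiagonalTuple {R : Type*} [CommSemiring R] {m : ℕ}
    (F : Fin m → R⟦X⟧) (n : ℕ) :
    coeff n (∏ i, F i) = ∑ j ∈ Finset.Nat.antidiagonalTuple m n, ∏ i, coeff (j i) (F i) := by
  rw [coeff_prod]
  refine sum_bij' (fun l _ => l) (fun j _ => Finsupp.equivFunOnFinite.symm j) ?_ ?_ ?_ ?_ ?_ <;>
    simp [Finset.Nat.mem_antidiagonalTuple, mem_finsuppAntidiag]

open PowerSeries in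
theorem PowerSeries.prod_rescale_exp {A ι : Type*} [CommRing A] [Algebra ℚ A] (s : Finset ι)
    (a : ι → A) : ∏ i ∈ s, rescale (a i) (exp A) = rescale (∑ i ∈ s, a i) (exp A) := by
  classical
  induction s using Finset.induction_on with
  | empty => simp
  | insert i s hi ih => rw [prod_insert hi, sum_insert hi, ih, exp_mul_exp_eq_exp_add]

open PowerSeries in
/-- The exponential generating function of `n ↦ Δ^k I_n(x)` is `e^{xz} (e^z - 1)^k`. -/
theorem fdiff_pow_eq_factorial_mul_coeff (k n : ℕ) (x : ℝ) :
    fdiff k (fun y => y ^ n) x =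
      n.factorial * coeff n (rescale x (exp ℝ) * (exp ℝ - 1) ^ k) := by
  have hfac : (n.factorial : ℝ) ≠ 0 := by positivity
  rw [sub_eq_add_neg, add_pow, mul_sum, map_sum, mul_sum, fdiff]
  refine sum_congr rfl fun j _ => ?_
  have hseries : rescale x (exp ℝ) * (exp ℝ ^ j * (-1) ^ (k - j) * (k.choose j : ℝ⟦X⟧)) =
      C ((k.choose j : ℝ) * (-1) ^ (k - j)) * rescale (x + j) (exp ℝ) := by
    rw [← exp_mul_exp_eq_exp_add, ← exp_pow_eq_rescale_exp]
    simp only [map_mul, map_pow, map_neg, map_one, map_natCast]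
    ring
  rw [hseries, coeff_C_mul, coeff_rescale, coeff_exp]
  simp only [map_div₀, map_one, map_natCast]
  field_simp

theorem rchoose_neg_succ (d k : ℕ) :
    rchoose (-((d + 1 : ℕ) : ℝ)) k = (-1) ^ k * ((d + k).choose d : ℝ) := by
  have hprod : ∏ i ∈ range k, (-((d + 1 : ℕ) : ℝ) - i) =
      (-1) ^ k * ((k.factorial * (d + k).choose k : ℕ) : ℝ) := by
    rw [← Nat.ascFactorial_eq_factorial_mul_choose, Nat.ascFactorial_eq_prod_range]
    push_cast
    rw [← card_range k, ← prod_const, card_range, ← prod_mul_distrib]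
    exact prod_congr rfl fun i _ => by ring
  have hfac : (k.factorial : ℝ) ≠ 0 := by positivity
  rw [rchoose, hprod, Nat.choose_symm_add]
  push_cast
  field_simp

open PowerSeries in
theorem coeff_rescale_mk_one_pow_succ (β : ℝ) (d k : ℕ) :
    coeff k (rescale (-β) (PowerSeries.mk 1 : ℝ⟦X⟧) ^ (d + 1)) =
      rchoose (-((d + 1 : ℕ) : ℝ)) k * β ^ k := by
  rw [← map_pow, mk_one_pow_eq_mk_choose_add, coeff_rescale, coeff_mk, rchoose_neg_succ, neg_pow]
  ring

open PowerSeries in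
/-- The exponential generating function of the Apostol-Euler polynomials, with
`1 / (1 + β (e^z - 1))` written as a substitution in the series of `1 / (1 + β z)`. -/
theorem apostolEuler_eq_factorial_mul_coeff (β x : ℝ) (n : ℕ) :
    apostolEuler β n x = n.factorial *
      coeff n (rescale x (exp ℝ) * (rescale (-β) (PowerSeries.mk 1 : ℝ⟦X⟧)).subst (exp ℝ - 1)) := by
  rw [coeff_mul_subst_eq_sum_range (by simp), mul_sum, apostolEuler]
  refine sum_congr rfl fun k _ => ?_
  rw [fdiff_pow_eq_factorial_mul_coeff, coeff_rescale, coeff_mk, Pi.one_apply]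
  ring

/-- higher-order convolution identity for Apostol-Euler polynomials:
`∑_{j₁+⋯+j_m=n} (n!/∏jᵢ!) E_{j₁}(β;x₁)⋯E_{j_m}(β;x_m)
  = ∑_{k=0}^n C(-m,k) β^k Δ^k I_n(x)`. -/
theorem apostolEuler_multinomial_convolution (m : ℕ) (hm : 1 ≤ m) (β : ℝ)
    (hβ0 : 0 ≤ β) (hβ1 : β ≤ 1) (xs : Fin m → ℝ) (x : ℝ) (hx : ∑ i, xs i = x) (n : ℕ) :
    ∑ j ∈ Finset.Nat.antidiagonalTuple m n,
        (n.factorial : ℝ) / (∏ i, ((j i).factorial : ℝ)) * ∏ i, apostolEuler β (j i) (xs i)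
      = ∑ k ∈ Finset.range (n + 1),
          rchoose (-(m : ℝ)) k * β ^ k * fdiff k (fun y => y ^ n) x := by
  obtain ⟨d, rfl⟩ : ∃ d, m = d + 1 := ⟨m - 1, by lia⟩
  have hsubst : PowerSeries.HasSubst (PowerSeries.exp ℝ - 1) :=
    PowerSeries.HasSubst.of_constantCoeff_zero' (by simp)
  have hprod := PowerSeries.coeff_prod_eq_sum_antidiagonalTuple (fun i => PowerSeries.rescale (xs i)
    (PowerSeries.exp ℝ) * (PowerSeries.rescale (-β) (PowerSeries.mk 1)).subst
      (PowerSeries.exp ℝ - 1)) n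
  rw [prod_mul_distrib, PowerSeries.prod_rescale_exp, hx, prod_const, card_univ, Fintype.card_fin,
    ← PowerSeries.subst_pow hsubst, PowerSeries.coeff_mul_subst_eq_sum_range (by simp)] at hprod
  calc
    _ = (n.factorial : ℝ) * ∑ j ∈ Finset.Nat.antidiagonalTuple (d + 1) n, ∏ i,
          PowerSeries.coeff (j i) (PowerSeries.rescale (xs i) (PowerSeries.exp ℝ) *
            (PowerSeries.rescale (-β) (PowerSeries.mk 1)).subst (PowerSeries.exp ℝ - 1)) := by
      rw [mul_sum]
      refine sum_congr rfl fun j _ => ?_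
      have hfac : ∏ i, ((j i).factorial : ℝ) ≠ 0 := prod_ne_zero_iff.2 fun i _ => by positivity
      simp only [apostolEuler_eq_factorial_mul_coeff, prod_mul_distrib]
      rw [← mul_assoc, div_mul_cancel₀ _ hfac]
    _ = _ := by
      rw [← hprod, mul_sum]
      refine sum_congr rfl fun k _ => ?_
      rw [coeff_rescale_mk_one_pow_succ, fdiff_pow_eq_factorial_mul_coeff]
      ring
end
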